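/- Let Ω be a finite set, F₁, F₂ ∈ D(Ω), and let G₀ = F₁ ⊎ F₂, G₁, …, G_n be a sequence of multisets of subsets of Ω obtained by successively applying properly intersecting elimination operations. If X, Y ∈ G_i are properly intersecting, then both X and Y are maximal members of G_i (i.e. X, Y ∈ G_i', the family of maximal members of G_i). -/

import Mathlib

section Pieo

variable {Ω : Type} [DecidableEq Ω]

/-- Two finite sets `X, Y` are properly intersecting if `X ∩ Y`, `X \ Y`,
`Y \ X` are all nonempty. -/
def ProperlyIntersecting (X Y : Finset Ω) : Prop :=
  (X ∩ Y).Nonempty ∧ (X \ Y).Nonempty ∧ (Y \ X).Nonempty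

/-- The three types of properly intersecting elimination operations. -/
inductive PieoType : Type
  | one : PieoType
  | two : PieoType
  | three : PieoType
deriving DecidableEq

/-- `pieoStep τ G G'` : `G'` is obtained from the multiset `G` by a properly
intersecting elimination operation (PIEO) of type `τ` on some properly
intersecting pair `X, Y` of members of `G`:  Type 1 replaces `X, Y` by `X ∪ Y`
and `X ∩ Y`, Type 2 replaces them by `X ∪ Y` only, Type 3 by `X ∩ Y` only. -/
def pieoStep (τ : PieoType) (G G' : Multiset (Finset Ω)) : Prop :=
  ∃ X Y H, ProperlyIntersecting X Y ∧ G = X ::ₘ Y ::ₘ H ∧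
    G' = (match τ with
      | PieoType.one => (X ∪ Y) ::ₘ (X ∩ Y) ::ₘ H
      | PieoType.two => (X ∪ Y) ::ₘ H
      | PieoType.three => (X ∩ Y) ::ₘ H)

/-- `G(v)`: the number of members of the multiset `G` (with multiplicity)
containing `v`. -/
def countMem (G : Multiset (Finset Ω)) (v : Ω) : ℕ :=
  Multiset.countP (fun X => v ∈ X) G

/-- A member `Z` of the multiset `G` is maximal if no member of `G` properly
contains it. -/
def IsMaxMember (G : Multiset (Finset Ω)) (Z : Finset Ω) : Prop :=
  ∀ W ∈ G, ¬ Z ⊂ W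

/-- A multiset of sets is laminar if it contains no properly intersecting pair. -/
def LaminarM (G : Multiset (Finset Ω)) : Prop :=
  ∀ X ∈ G, ∀ Y ∈ G, ¬ ProperlyIntersecting X Y

/-- The family of maximal members of `G` (each listed once). -/
def maxMembers (G : Multiset (Finset Ω)) : Multiset (Finset Ω) :=
  (G.filter fun Z => ∀ W ∈ G, ¬ Z ⊂ W).dedup

/-- The union `∪F` of all members of the multiset `F`. -/
def msUnion (G : Multiset (Finset Ω)) : Finset Ω :=
  G.sup

/-- The partial order on families of disjoint subsets: `F ≤ G` iff every member
of `F` is contained in some member of `G`. -/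
def famLE (F G : Multiset (Finset Ω)) : Prop :=
  ∀ X ∈ F, ∃ Y ∈ G, X ⊆ Y

end Pieo

theorem countMem_le_one_of_pairwise_disjoint {Ω : Type} [DecidableEq Ω]
    {F : Multiset (Finset Ω)} (hF : F.Pairwise fun X Y => Disjoint X Y) (v : Ω) :
    countMem F v ≤ 1 := by
  obtain ⟨l, rfl, hl⟩ := hF
  unfold countMem
  rw [Multiset.coe_countP]
  induction hl with
  | nil => simp
  | @cons X l hX _ ih =>
    rw [List.countP_cons]
    by_cases hv : v ∈ X
    · have h0 : l.countP (fun X => decide (v ∈ X)) = 0 := by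
        rw [List.countP_eq_zero]
        intro Y hY
        simpa using Finset.disjoint_left.mp (hX Y hY) hv
      simp [h0, hv]
    · simpa [hv] using ih

theorem pieoStep.countMem_le {Ω : Type} [DecidableEq Ω] {τ : PieoType}
    {G G' : Multiset (Finset Ω)} (h : pieoStep τ G G') (v : Ω) :
    countMem G' v ≤ countMem G v := by
  obtain ⟨X, Y, H, -, rfl, rfl⟩ := h
  cases τ <;> by_cases hX : v ∈ X <;> by_cases hY : v ∈ Y <;>
    simp [countMem, hX, hY]

theorem ProperlyIntersecting.symm {Ω : Type} [DecidableEq Ω] {X Y : Finset Ω}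
    (h : ProperlyIntersecting X Y) : ProperlyIntersecting Y X :=
  ⟨Finset.inter_comm X Y ▸ h.1, h.2.2, h.2.1⟩

theorem ProperlyIntersecting.isMaxMember {Ω : Type} [DecidableEq Ω]
    {G : Multiset (Finset Ω)} (hG : ∀ v, countMem G v ≤ 2) {X Y : Finset Ω}
    (hX : X ∈ G) (hY : Y ∈ G) (h : ProperlyIntersecting X Y) : IsMaxMember G X := by
  intro W hW hXW
  obtain ⟨⟨v, hv⟩, hXY, -⟩ := h
  obtain ⟨hvX, hvY⟩ := Finset.mem_inter.mp hv
  rw [Finset.sdiff_nonempty] at hXY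
  have hne : X ≠ Y := fun e => hXY e.subset
  have hne' : Y ≠ W := fun e => hXY (e ▸ hXW.subset)
  have hnodup : ({X, Y, W} : Multiset (Finset Ω)).Nodup := by
    simp [hne, hne', hXW.ne]
  have hle : ({X, Y, W} : Multiset (Finset Ω)) ≤ G := by
    rw [Multiset.le_iff_subset hnodup]
    intro Z hZ
    simp only [Multiset.insert_eq_cons, Multiset.mem_cons, Multiset.mem_singleton] at hZ
    rcases hZ with rfl | rfl | rfl <;> assumption
  have hcount := (Multiset.countP_le_of_le (fun Z => v ∈ Z) hle).trans (hG v)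
  simp [Multiset.insert_eq_cons, ← Multiset.cons_zero, hvX, hvY,
    hXW.subset hvX] at hcount

/-- **Proposition.**  Along a sequence of PIEOs starting from `G₀ = F₁ ⊎ F₂`
with `F₁, F₂ ∈ D(Ω)`: if `X, Y ∈ G_i` are properly intersecting, then both `X`
and `Y` are maximal members of `G_i`. -/
theorem pieo_properly_intersecting_are_maximal
    {Ω : Type} [Fintype Ω] [DecidableEq Ω]
    (F₁ F₂ : Multiset (Finset Ω))
    (hF₁ : F₁.Pairwise fun X Y => Disjoint X Y)
    (hF₂ : F₂.Pairwise fun X Y => Disjoint X Y)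
    (n : ℕ) (G : Fin (n + 1) → Multiset (Finset Ω))
    (τ : Fin n → PieoType)
    (hG0 : G 0 = F₁ + F₂)
    (hstep : ∀ i : Fin n, pieoStep (τ i) (G i.castSucc) (G i.succ)) :
    ∀ (i : Fin (n + 1)) (X Y : Finset Ω), X ∈ G i → Y ∈ G i →
      ProperlyIntersecting X Y →
      IsMaxMember (G i) X ∧ IsMaxMember (G i) Y := by
  have hcount : ∀ (i : Fin (n + 1)) (v : Ω), countMem (G i) v ≤ 2 := by
    intro i v
    induction i using Fin.induction with
    | zero =>
      rw [hG0, countMem, Multiset.countP_add]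
      exact Nat.add_le_add (countMem_le_one_of_pairwise_disjoint hF₁ v)
        (countMem_le_one_of_pairwise_disjoint hF₂ v)
    | succ i ih => exact ((hstep i).countMem_le v).trans ih
  intro i X Y hX hY h
  exact ⟨h.isMaxMember (hcount i) hX hY, h.symm.isMaxMember (hcount i) hY hX⟩
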